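/- Let M be a finite-valued random variable and let (B₁, …, B_n), (C₁, …, C_n) be finite-valued random variables on the same probability space. For each i ∈ {1, …, n}, define V_i = (M, B₁, …, B_{i−1}, C₁, …, C_{i−1}), and assume the Markov chain B_i − (M, B₁,…,B_{i−1}, C₁,…,C_i) − (C_{i+1}, …, C_n) holds, i.e., I(B_i; (C_{i+1},…,C_n) | (M, B₁,…,B_{i−1}, C₁,…,C_i)) = 0. Then I(M; (B₁,…,B_n) | (C₁,…,C_n)) ≤ Σ_{i=1}^n I(V_i; B_i | C_i). -/

import Mathlib

/- Shannon entropy and conditional mutual information of finite-valued random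
variables on a probability space. -/

open MeasureTheory

noncomputable def ent {Ω : Type*} [MeasurableSpace Ω] (μ : Measure Ω) {α : Type*} [Fintype α]
    (X : Ω → α) : ℝ :=
  ∑ a, Real.negMulLog (μ (X ⁻¹' {a})).toReal

/-- Conditional mutual information `I(X;Z|Y)`. -/
noncomputable def cmi {Ω : Type*} [MeasurableSpace Ω] (μ : Measure Ω) {α β γ : Type*}
    [Fintype α] [Fintype β] [Fintype γ] (X : Ω → α) (Z : Ω → β) (Y : Ω → γ) : ℝ :=
  ent μ (fun ω => (X ω, Y ω)) + ent μ (fun ω => (Z ω, Y ω))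
    - ent μ (fun ω => (X ω, Z ω, Y ω)) - ent μ Y

theorem exists_eq_of_negMulLog_ne_zero {Ω α : Type*} [MeasurableSpace Ω]
    {μ : Measure Ω} {X : Ω → α} {a : α} (ha : (μ (X ⁻¹' {a})).toReal.negMulLog ≠ 0) :
    ∃ ω, X ω = a := by
  by_contra! hne
  have hempty : X ⁻¹' {a} = ∅ := by
    ext ω
    simp [hne ω]
  simp [hempty] at ha

/-- Entropy depends only on the partition of `Ω` into the fibres of the random variable. -/
theorem ent_congr {Ω : Type*} [MeasurableSpace Ω] (μ : Measure Ω) {α β : Type*}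
    [Fintype α] [Fintype β] {X : Ω → α} {Y : Ω → β}
    (h : ∀ ω ω', X ω = X ω' ↔ Y ω = Y ω') : ent μ X = ent μ Y := by
  have fibre_eq : ∀ ω, X ⁻¹' {X ω} = Y ⁻¹' {Y ω} := by
    intro ω
    ext ω'
    simpa using h ω' ω
  unfold ent
  refine Finset.sum_bij_ne_zero
    (fun a _ ha => Y (exists_eq_of_negMulLog_ne_zero ha).choose)
    (fun _ _ _ => Finset.mem_univ _) ?_ ?_ ?_
  · intro a _ ha b _ hb hab
    rw [← (exists_eq_of_negMulLog_ne_zero ha).choose_spec,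
      ← (exists_eq_of_negMulLog_ne_zero hb).choose_spec]
    exact (h _ _).2 hab
  · intro b _ hb
    obtain ⟨ω, rfl⟩ := exists_eq_of_negMulLog_ne_zero hb
    have ha : Real.negMulLog (μ (X ⁻¹' {X ω})).toReal ≠ 0 := by rwa [fibre_eq ω]
    exact ⟨X ω, Finset.mem_univ _, ha,
      (h _ _).1 (exists_eq_of_negMulLog_ne_zero ha).choose_spec⟩
  · intro a _ ha
    have hω := (exists_eq_of_negMulLog_ne_zero ha).choose_spec
    rw [← fibre_eq, hω]

theorem fibre_prodMk {Ω α β : Type*} (X : Ω → α) (Y : Ω → β) (a : α) (b : β) :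
    (fun ω => (X ω, Y ω)) ⁻¹' {(a, b)} = X ⁻¹' {a} ∩ Y ⁻¹' {b} := by
  ext ω
  simp

theorem measurableSet_fibre_prodMk {Ω α β : Type*} [MeasurableSpace Ω] {X : Ω → α} {Y : Ω → β}
    (hX : ∀ a, MeasurableSet (X ⁻¹' {a})) (hY : ∀ b, MeasurableSet (Y ⁻¹' {b})) (p : α × β) :
    MeasurableSet ((fun ω => (X ω, Y ω)) ⁻¹' {p}) := by
  rw [← Prod.mk.eta (p := p), fibre_prodMk]
  exact (hX _).inter (hY _)

theorem measurableSet_fibre_pi {Ω ι α : Type*} [MeasurableSpace Ω] [Countable ι] {X : ι → Ω → α}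
    (hX : ∀ i a, MeasurableSet (X i ⁻¹' {a})) (f : ι → α) :
    MeasurableSet ((fun ω i => X i ω) ⁻¹' {f}) := by
  have h : (fun ω i => X i ω) ⁻¹' {f} = ⋂ i, X i ⁻¹' {f i} := by
    ext ω
    simp [funext_iff]
  rw [h]
  exact MeasurableSet.iInter fun i => hX i _

theorem toReal_measure_eq_sum_inter_fibre {Ω α : Type*} [MeasurableSpace Ω] (μ : Measure Ω)
    [IsFiniteMeasure μ] [Fintype α] {X : Ω → α} (hX : ∀ a, MeasurableSet (X ⁻¹' {a}))
    (s : Set Ω) : (μ s).toReal = ∑ a, (μ (X ⁻¹' {a} ∩ s)).toReal := by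
  have h := sum_measure_preimage_singleton (μ := μ.restrict s) Finset.univ (f := X)
    (fun a _ => hX a)
  simp only [Finset.coe_univ, Set.preimage_univ, Measure.restrict_apply_univ,
    Measure.restrict_apply (hX _)] at h
  rw [← h, ENNReal.toReal_sum fun _ _ => measure_ne_top _ _]

/-- Submodularity of entropy for a nonnegative array, in terms of its marginals. -/
theorem sum_negMulLog_submodular {α β γ : Type*} [Fintype α] [Fintype β] [Fintype γ]
    {P : α → β → γ → ℝ} (hP : ∀ x z y, 0 ≤ P x z y) {Q : α → γ → ℝ} {R : β → γ → ℝ} {S : γ → ℝ}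
    (hQ : ∀ x y, Q x y = ∑ z, P x z y) (hR : ∀ z y, R z y = ∑ x, P x z y)
    (hSQ : ∀ y, S y = ∑ x, Q x y) (hSR : ∀ y, S y = ∑ z, R z y) :
    ∑ y, ∑ x, ∑ z, (P x z y).negMulLog + ∑ y, (S y).negMulLog
      ≤ ∑ y, ∑ x, (Q x y).negMulLog + ∑ y, ∑ z, (R z y).negMulLog := by
  simp only [← Finset.sum_add_distrib]
  refine Finset.sum_le_sum fun y _ => ?_
  have hQ0 : ∀ x, 0 ≤ Q x y := fun x => hQ x y ▸ Finset.sum_nonneg fun z _ => hP x z y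
  have hR0 : ∀ z, 0 ≤ R z y := fun z => hR z y ▸ Finset.sum_nonneg fun x _ => hP x z y
  have hS0 : 0 ≤ S y := hSQ y ▸ Finset.sum_nonneg fun x _ => hQ0 x
  have hpt : ∀ x z, P x z y - Q x y * R z y / S y ≤
      P x z y * (Real.log (P x z y) + Real.log (S y) - Real.log (Q x y) - Real.log (R z y)) := by
    intro x z
    rcases (hP x z y).eq_or_lt with h0 | hpos
    · rw [← h0]
      have := div_nonneg (mul_nonneg (hQ0 x) (hR0 z)) hS0
      linarith
    · have hQpos : 0 < Q x y := hpos.trans_le <| hQ x y ▸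
        Finset.single_le_sum (f := fun z => P x z y) (fun z _ => hP x z y) (Finset.mem_univ z)
      have hRpos : 0 < R z y := hpos.trans_le <| hR z y ▸
        Finset.single_le_sum (f := fun x => P x z y) (fun x _ => hP x z y) (Finset.mem_univ x)
      have hSpos : 0 < S y := hQpos.trans_le <| hSQ y ▸
        Finset.single_le_sum (f := fun x => Q x y) (fun x _ => hQ0 x) (Finset.mem_univ x)
      have hlog := Real.log_le_sub_one_of_pos
        (div_pos (mul_pos hQpos hRpos) (mul_pos hpos hSpos))
      rw [Real.log_div (by positivity) (by positivity), Real.log_mul hQpos.ne' hRpos.ne',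
        Real.log_mul hpos.ne' hSpos.ne'] at hlog
      have hmul := mul_le_mul_of_nonneg_left hlog hpos.le
      have hcancel : P x z y * (Q x y * R z y / (P x z y * S y) - 1)
          = Q x y * R z y / S y - P x z y := by
        field_simp
      linarith
  have hsum := Finset.sum_le_sum fun x (_ : x ∈ Finset.univ) =>
    Finset.sum_le_sum fun z (_ : z ∈ Finset.univ) => hpt x z
  have hprod : ∑ x, ∑ z, Q x y * R z y / S y = S y := by
    simp_rw [← Finset.sum_div, ← Finset.mul_sum, ← hSR, ← Finset.sum_mul, ← hSQ,
      mul_self_div_self]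
  have hS : ∑ x, ∑ z, P x z y * Real.log (S y) = S y * Real.log (S y) := by
    simp_rw [← Finset.sum_mul, ← hQ, ← hSQ]
  have hQ' : ∑ x, ∑ z, P x z y * Real.log (Q x y) = ∑ x, Q x y * Real.log (Q x y) := by
    simp_rw [← Finset.sum_mul, ← hQ]
  have hR' : ∑ x, ∑ z, P x z y * Real.log (R z y) = ∑ z, R z y * Real.log (R z y) := by
    rw [Finset.sum_comm]
    simp_rw [← Finset.sum_mul, ← hR]
  have hP' : ∑ x, ∑ z, P x z y = S y := by
    simp_rw [← hQ, ← hSQ]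
  simp only [mul_sub, mul_add, Finset.sum_sub_distrib, Finset.sum_add_distrib, hprod, hS, hQ',
    hR', hP'] at hsum
  simp only [Real.negMulLog, neg_mul, Finset.sum_neg_distrib]
  linarith

theorem cmi_nonneg {Ω : Type*} [MeasurableSpace Ω] (μ : Measure Ω) [IsFiniteMeasure μ]
    {α β γ : Type*} [Fintype α] [Fintype β] [Fintype γ] {X : Ω → α} {Z : Ω → β} (Y : Ω → γ)
    (hX : ∀ a, MeasurableSet (X ⁻¹' {a})) (hZ : ∀ b, MeasurableSet (Z ⁻¹' {b})) :
    0 ≤ cmi μ X Z Y := by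
  have h := sum_negMulLog_submodular
    (P := fun x z y => (μ (X ⁻¹' {x} ∩ (Z ⁻¹' {z} ∩ Y ⁻¹' {y}))).toReal)
    (Q := fun x y => (μ (X ⁻¹' {x} ∩ Y ⁻¹' {y})).toReal)
    (R := fun z y => (μ (Z ⁻¹' {z} ∩ Y ⁻¹' {y})).toReal)
    (S := fun y => (μ (Y ⁻¹' {y})).toReal)
    (fun _ _ _ => ENNReal.toReal_nonneg)
    (fun x y => by
      simp_rw [Set.inter_left_comm (X ⁻¹' {x})]
      exact toReal_measure_eq_sum_inter_fibre μ hZ _)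
    (fun z y => toReal_measure_eq_sum_inter_fibre μ hX _)
    (fun y => toReal_measure_eq_sum_inter_fibre μ hX _)
    (fun y => toReal_measure_eq_sum_inter_fibre μ hZ _)
  have hXY : ent μ (fun ω => (X ω, Y ω))
      = ∑ y, ∑ x, (μ (X ⁻¹' {x} ∩ Y ⁻¹' {y})).toReal.negMulLog := by
    simp_rw [ent, Fintype.sum_prod_type_right, fibre_prodMk]
  have hZY : ent μ (fun ω => (Z ω, Y ω))
      = ∑ y, ∑ z, (μ (Z ⁻¹' {z} ∩ Y ⁻¹' {y})).toReal.negMulLog := by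
    simp_rw [ent, Fintype.sum_prod_type_right, fibre_prodMk]
  have hXZY : ent μ (fun ω => (X ω, Z ω, Y ω))
      = ∑ y, ∑ x, ∑ z, (μ (X ⁻¹' {x} ∩ (Z ⁻¹' {z} ∩ Y ⁻¹' {y}))).toReal.negMulLog := by
    simp_rw [ent, Fintype.sum_prod_type, Finset.sum_comm (s := (Finset.univ : Finset β)),
      fibre_prodMk]
    exact Finset.sum_comm
  rw [cmi, hXY, hZY, hXZY, ent]
  linarith

/-- with `V_i = (M, B^{i−1}, C^{i−1})` and the Markov chains
`B_i − (M, B^{i−1}, C^i) − (C_{i+1},…,C_n)`, one has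
`I(M; B^n | C^n) ≤ ∑_{i=1}^n I(V_i; B_i | C_i)`. -/
theorem multi_letter_to_single_letter_conditional
    {Ω : Type*} [MeasurableSpace Ω] (μ : Measure Ω) [IsProbabilityMeasure μ]
    {𝓜 β γ : Type*} [Fintype 𝓜] [Fintype β] [Fintype γ]
    {n : ℕ} (M : Ω → 𝓜) (B : Fin n → Ω → β) (C : Fin n → Ω → γ)
    (hM : ∀ m, MeasurableSet (M ⁻¹' {m}))
    (hB : ∀ i b, MeasurableSet (B i ⁻¹' {b}))
    (hC : ∀ i c, MeasurableSet (C i ⁻¹' {c}))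
    (hMarkov : ∀ i : Fin n,
      cmi μ (B i)
        (fun ω => fun j : {j : Fin n // i < j} => C j.1 ω)
        (fun ω => (M ω,
          fun j : {j : Fin n // j < i} => B j.1 ω,
          fun j : {j : Fin n // j ≤ i} => C j.1 ω)) = 0) :
    cmi μ M (fun ω => fun i : Fin n => B i ω) (fun ω => fun i : Fin n => C i ω)
      ≤ ∑ i : Fin n,
          cmi μ
            (fun ω => (M ω,
              fun j : {j : Fin n // j < i} => B j.1 ω,
              fun j : {j : Fin n // j < i} => C j.1 ω))
            (B i) (C i) := by
  set h : ℕ → ℝ := fun k => ent μ fun ω =>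
    (M ω, (fun j : {j : Fin n // j.1 < k} => B j.1 ω), fun j => C j ω)
  set g : ℕ → ℝ := fun k => ent μ fun ω =>
    ((fun j : {j : Fin n // j.1 < k} => B j.1 ω), fun j => C j ω)
  have telescope : ∀ f : ℕ → ℝ, ∑ i : Fin n, (f (i + 1) - f i) = f n - f 0 := fun f => by
    rw [Fin.sum_univ_eq_sum_range (fun i => f (i + 1) - f i), Finset.sum_range_sub]
  have hcmi : cmi μ M (fun ω => fun i : Fin n => B i ω) (fun ω => fun i : Fin n => C i ω)
      = ∑ i : Fin n, ((g (i + 1) - g i) - (h (i + 1) - h i)) := by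
    rw [Finset.sum_sub_distrib, telescope, telescope, cmi]
    have e₁ : ent μ (fun ω => (M ω, fun i : Fin n => C i ω)) = h 0 :=
      ent_congr μ fun ω ω' => by simp [funext_iff]
    have e₂ : ent μ (fun ω => ((fun i : Fin n => B i ω), fun i : Fin n => C i ω)) = g n :=
      ent_congr μ fun ω ω' => by simp [funext_iff]
    have e₃ : ent μ (fun ω => (M ω, (fun i : Fin n => B i ω), fun i : Fin n => C i ω)) = h n :=
      ent_congr μ fun ω ω' => by simp [funext_iff]
    have e₄ : ent μ (fun ω => fun i : Fin n => C i ω) = g 0 :=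
      ent_congr μ fun ω ω' => by simp [funext_iff]
    rw [e₁, e₂, e₃, e₄]
    ring
  rw [hcmi]
  refine Finset.sum_le_sum fun i _ => ?_
  have hsub : g (i + 1) - g i ≤ ent μ (fun ω => (B i ω, C i ω)) - ent μ (C i) := by
    have hnn := cmi_nonneg μ (X := B i)
      (Z := fun ω => ((fun j : {j : Fin n // j.1 < i.1} => B j.1 ω), fun j => C j ω))
      (C i) (hB i)
      (measurableSet_fibre_prodMk (measurableSet_fibre_pi fun j => hB j.1)
        (measurableSet_fibre_pi hC))
    rw [cmi] at hnn
    have e₁ : ent μ (fun ω => (((fun j : {j : Fin n // j.1 < i.1} => B j.1 ω),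
        fun j => C j ω), C i ω)) = g i :=
      ent_congr μ fun ω ω' => by
        simp only [Prod.mk.injEq, funext_iff, Subtype.forall]
        grind
    have e₂ : ent μ (fun ω => (B i ω, ((fun j : {j : Fin n // j.1 < i.1} => B j.1 ω),
        fun j => C j ω), C i ω)) = g (i + 1) :=
      ent_congr μ fun ω ω' => by
        simp only [Prod.mk.injEq, funext_iff, Subtype.forall]
        grind
    rw [e₁, e₂] at hnn
    linarith
  have hmk := hMarkov i
  rw [cmi] at hmk ⊢
  have e₁ : ent μ (fun ω => ((fun j : {j : Fin n // i < j} => C j.1 ω), M ω,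
      (fun j : {j : Fin n // j < i} => B j.1 ω), fun j : {j : Fin n // j ≤ i} => C j.1 ω))
      = h i :=
    ent_congr μ fun ω ω' => by
      simp only [Prod.mk.injEq, funext_iff, Subtype.forall]
      grind
  have e₂ : ent μ (fun ω => (B i ω, (fun j : {j : Fin n // i < j} => C j.1 ω), M ω,
      (fun j : {j : Fin n // j < i} => B j.1 ω), fun j : {j : Fin n // j ≤ i} => C j.1 ω))
      = h (i + 1) :=
    ent_congr μ fun ω ω' => by
      simp only [Prod.mk.injEq, funext_iff, Subtype.forall]
      grind
  have e₃ : ent μ (fun ω => (M ω, (fun j : {j : Fin n // j < i} => B j.1 ω),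
      fun j : {j : Fin n // j ≤ i} => C j.1 ω))
      = ent μ (fun ω => ((M ω, (fun j : {j : Fin n // j < i} => B j.1 ω),
        fun j : {j : Fin n // j < i} => C j.1 ω), C i ω)) :=
    ent_congr μ fun ω ω' => by
      simp only [Prod.mk.injEq, funext_iff, Subtype.forall]
      grind
  have e₄ : ent μ (fun ω => (B i ω, M ω, (fun j : {j : Fin n // j < i} => B j.1 ω),
      fun j : {j : Fin n // j ≤ i} => C j.1 ω))
      = ent μ (fun ω => ((M ω, (fun j : {j : Fin n // j < i} => B j.1 ω),
        fun j : {j : Fin n // j < i} => C j.1 ω), B i ω, C i ω)) :=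
    ent_congr μ fun ω ω' => by
      simp only [Prod.mk.injEq, funext_iff, Subtype.forall]
      grind
  rw [e₁, e₂, e₃, e₄] at hmk
  linarith
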